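/- If X is a nondegenerate unicoherent Peano continuum without free arcs, then CB(X) is a dense G_δ-subset of C(X). -/

import Mathlib

open Set Topology Metric

noncomputable section

/-- The hyperspace `2^X` of nonempty compact (= closed, for compact `X`) subsets of `X`,
with the Hausdorff metric. -/
abbrev Hyper (X : Type*) [MetricSpace X] := TopologicalSpace.NonemptyCompacts X

/-- `C(X)`: the subcontinua of `X`, i.e. the connected members of the hyperspace. -/
def CSet (X : Type*) [MetricSpace X] : Set (Hyper X) :=
  {A | IsConnected (A : Set X)}

/-- `CB(X)`: proper subcontinua of `X` with connected boundary. -/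
def CBSet (X : Type*) [MetricSpace X] : Set (Hyper X) :=
  {A | IsConnected (A : Set X) ∧ (A : Set X) ≠ Set.univ ∧
    IsConnected (frontier (A : Set X))}

/-- `S(X)`: the members of the hyperspace that separate `X`,
i.e. whose complement is disconnected. -/
def SepSet (X : Type*) [MetricSpace X] : Set (Hyper X) :=
  {A | ¬ IsPreconnected ((A : Set X)ᶜ)}

/-- A set is `F_σ` if it is a countable union of closed sets. -/
def IsFsigma {α : Type*} [TopologicalSpace α] (s : Set α) : Prop :=
  ∃ F : ℕ → Set α, (∀ n, IsClosed (F n)) ∧ s = ⋃ n, F n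

/-- A set is `F_σδ` if it is a countable intersection of `F_σ` sets. -/
def IsFsigmaDelta {α : Type*} [TopologicalSpace α] (s : Set α) : Prop :=
  ∃ F : ℕ → Set α, (∀ n, IsFsigma (F n)) ∧ s = ⋂ n, F n

/-- A set is in the class `D_2(F_σ)` if it is a difference of two `F_σ` sets. -/
def IsD2Fsigma {α : Type*} [TopologicalSpace α] (s : Set α) : Prop :=
  ∃ u v : Set α, IsFsigma u ∧ IsFsigma v ∧ s = u \ v

/-- `X` is unicoherent: the intersection of any two closed connected sets covering `X`
is connected. -/
def Unicoherent (X : Type*) [TopologicalSpace X] : Prop :=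
  ∀ A B : Set X, IsClosed A → IsClosed B → IsConnected A → IsConnected B →
    A ∪ B = Set.univ → IsConnected (A ∩ B)

/-- An arc: a subspace homeomorphic to `[0,1]`. -/
def IsArc {X : Type*} [TopologicalSpace X] (A : Set X) : Prop :=
  Nonempty (unitInterval ≃ₜ A)

/-- A free arc: an arc which becomes open after removing its two endpoints. -/
def IsFreeArc {X : Type*} [TopologicalSpace X] (A : Set X) : Prop :=
  ∃ h : unitInterval ≃ₜ A, IsOpen (A \ {((h 0 : A) : X), ((h 1 : A) : X)})

/-- `Y` is π-`n`-Euclidean: it has a π-base consisting of open sets homeomorphic to `ℝⁿ`. -/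
def PiEuclidean (Y : Type*) [TopologicalSpace Y] (n : ℕ) : Prop :=
  ∃ 𝓤 : Set (Set Y),
    (∀ U ∈ 𝓤, IsOpen U ∧ U.Nonempty ∧ Nonempty (U ≃ₜ (Fin n → ℝ))) ∧
    ∀ V : Set Y, IsOpen V → V.Nonempty → ∃ U ∈ 𝓤, U ⊆ V

/-- The Hilbert cube `I^∞ = [0,1]^ℕ`. -/
abbrev Iinf : Type := ℕ → unitInterval

/-- The pseudo-interior `(0,1)^∞` of the Hilbert cube. -/
def pseudoInterior : Set Iinf := {t | ∀ k, 0 < (t k : ℝ) ∧ (t k : ℝ) < 1}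

/-- The pseudo-boundary `∂(I^∞) = I^∞ \ (0,1)^∞` of the Hilbert cube. -/
def pseudoBoundary : Set Iinf := pseudoInteriorᶜ

/-- A `Z`-set in a (Hilbert cube) metric space `Q`: a closed set `A` such that for every
`ε > 0` the identity can be `ε`-approximated by a map avoiding `A`. -/
def IsZSet {Q : Type*} [MetricSpace Q] (A : Set Q) : Prop :=
  IsClosed A ∧ ∀ ε : ℝ, 0 < ε →
    ∃ f : Q → Q, Continuous f ∧ (∀ x, dist (f x) x < ε) ∧ ∀ x, f x ∉ A

/-- A `σZ`-set: a countable union of `Z`-sets. -/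
def IsSigmaZSet {Q : Type*} [MetricSpace Q] (A : Set Q) : Prop :=
  ∃ Z : ℕ → Set Q, (∀ n, IsZSet (Z n)) ∧ A = ⋃ n, Z n

/-- `A ⊆ Q` is strongly `𝓜`-universal (for a class `𝓜` of subsets of the Hilbert cube
`I^∞`): every embedding `f : I^∞ → Q` sending a compact set `K` onto a `Z`-set can be
approximated by an embedding `g` onto a `Z`-set which agrees with `f` on `K` and with
`g⁻¹(A) \ K = M \ K`. -/
def StronglyUniversal {Q : Type*} [MetricSpace Q] (𝓜 : Set (Set Iinf)) (A : Set Q) : Prop :=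
  ∀ M ∈ 𝓜, ∀ K : Set Iinf, IsCompact K →
    ∀ f : Iinf → Q, IsEmbedding f → IsZSet (f '' K) →
      ∀ ε : ℝ, 0 < ε →
        ∃ g : Iinf → Q, IsEmbedding g ∧ IsZSet (Set.range g) ∧
          (∀ x, dist (g x) (f x) < ε) ∧ (∀ x ∈ K, g x = f x) ∧
          g ⁻¹' A \ K = M \ K

/-- Lebesgue covering dimension `≤ n`: every open cover has an open refinement which
covers and such that each point lies in at most `n + 1` members. -/
def CoveringDimLE (α : Type*) [TopologicalSpace α] (n : ℕ) : Prop :=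
  ∀ 𝓤 : Set (Set α), (∀ U ∈ 𝓤, IsOpen U) → ⋃₀ 𝓤 = Set.univ →
    ∃ 𝓥 : Set (Set α), (∀ V ∈ 𝓥, IsOpen V) ∧ ⋃₀ 𝓥 = Set.univ ∧
      (∀ V ∈ 𝓥, ∃ U ∈ 𝓤, V ⊆ U) ∧
      ∀ (x : α) (s : Finset (Set α)), ↑s ⊆ 𝓥 → (∀ V ∈ s, x ∈ V) → s.card ≤ n + 1

/-- An indecomposable continuum: not the union of two proper subcontinua. -/
def IndecomposableCont (X : Type*) [TopologicalSpace X] : Prop :=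
  ¬ ∃ A B : Set X, IsClosed A ∧ IsClosed B ∧ IsConnected A ∧ IsConnected B ∧
    A ≠ Set.univ ∧ B ≠ Set.univ ∧ A ∪ B = Set.univ

/-- A connected set meeting `C` but not contained in `C` meets the frontier of `C`. -/
lemma meets_frontier {X : Type*} [TopologicalSpace X] {N C : Set X} (hN : IsPreconnected N)
    (h1 : (N ∩ C).Nonempty) (h2 : (N ∩ Cᶜ).Nonempty) : (N ∩ frontier C).Nonempty := by
  by_contra h
  have hd : ∀ z ∈ N, z ∉ frontier C := fun z hz hf => h ⟨z, hz, hf⟩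
  have hcov : N ⊆ interior C ∪ (closure C)ᶜ := by
    intro z hz
    by_cases hc : z ∈ closure C
    · left
      by_contra hi
      exact hd z hz ⟨hc, hi⟩
    · exact Or.inr hc
  obtain ⟨a, haN, haC⟩ := h1
  obtain ⟨b, hbN, hbC⟩ := h2
  obtain ⟨z, -, hz1, hz2⟩ := hN _ _ isOpen_interior isClosed_closure.isOpen_compl hcov
    ⟨a, haN, (hcov haN).resolve_right fun hh => hh (subset_closure haC)⟩
    ⟨b, hbN, (hcov hbN).resolve_left fun hh => hbC (interior_subset hh)⟩
  exact hz2 (subset_closure (interior_subset hz1))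

/-- Small connected open neighbourhoods. -/
lemma exists_conn_nhd {X : Type*} [TopologicalSpace X] [LocallyConnectedSpace X] {x : X}
    {U : Set X} (hU : IsOpen U) (hx : x ∈ U) :
    ∃ N, IsOpen N ∧ IsPreconnected N ∧ x ∈ N ∧ N ⊆ U :=
  ⟨connectedComponentIn U x, hU.connectedComponentIn, isPreconnected_connectedComponentIn,
    mem_connectedComponentIn hx, connectedComponentIn_subset U x⟩

set_option linter.unusedSectionVars false

section comp
variable {X : Type*} [TopologicalSpace X] [LocallyConnectedSpace X] [ConnectedSpace X]

lemma comp_frontier_subset {A : Set X} (hA : IsClosed A) (c : X) :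
    frontier (connectedComponentIn Aᶜ c) ⊆ A := by
  intro z hz
  by_contra hzA
  have ho : IsOpen (connectedComponentIn Aᶜ z) := hA.isOpen_compl.connectedComponentIn
  obtain ⟨w, hw1, hw2⟩ := mem_closure_iff.1 hz.1 _ ho (mem_connectedComponentIn hzA)
  have e : connectedComponentIn Aᶜ c = connectedComponentIn Aᶜ z :=
    (connectedComponentIn_eq hw2).trans (connectedComponentIn_eq hw1).symm
  rw [e, ho.frontier_eq] at hz
  exact hz.2 (mem_connectedComponentIn hzA)

lemma comp_frontier_nonempty {A : Set X} (hAn : A.Nonempty) {c : X} (hc : c ∉ A) :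
    (frontier (connectedComponentIn Aᶜ c)).Nonempty := by
  rw [nonempty_frontier_iff]
  refine ⟨⟨c, mem_connectedComponentIn hc⟩, fun h => ?_⟩
  obtain ⟨a, ha⟩ := hAn
  exact connectedComponentIn_subset Aᶜ c (h ▸ mem_univ a) ha

lemma comp_frontier_connected (huc : Unicoherent X) {A : Set X} (hA : IsClosed A)
    (hAc : IsConnected A) {c : X} (hc : c ∉ A) :
    IsConnected (frontier (connectedComponentIn Aᶜ c)) := by
  have ho : ∀ c, IsOpen (connectedComponentIn Aᶜ c) :=
    fun c => hA.isOpen_compl.connectedComponentIn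
  obtain ⟨a, ha⟩ := hAc.nonempty
  have haC : ∀ c, a ∉ connectedComponentIn Aᶜ c :=
    fun c h => connectedComponentIn_subset Aᶜ c h ha
  have hco : IsConnected (connectedComponentIn Aᶜ c)ᶜ := by
    refine ⟨⟨a, haC c⟩, isPreconnected_of_forall a fun z hz => ?_⟩
    have hAs : A ⊆ (connectedComponentIn Aᶜ c)ᶜ :=
      fun w hw h => connectedComponentIn_subset Aᶜ c h hw
    by_cases hzA : z ∈ A
    · exact ⟨A, hAs, ha, hzA, hAc.isPreconnected⟩
    · obtain ⟨w, hw⟩ := comp_frontier_nonempty hAc.nonempty hzA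
      refine ⟨A ∪ closure (connectedComponentIn Aᶜ z), union_subset hAs ?_, Or.inl ha,
        Or.inr (subset_closure (mem_connectedComponentIn hzA)), ?_⟩
      · intro w hw hwc
        obtain ⟨v, hv1, hv2⟩ := mem_closure_iff.1 hw _ (ho c) hwc
        apply hz
        rw [(connectedComponentIn_eq hv1).trans (connectedComponentIn_eq hv2).symm]
        exact mem_connectedComponentIn hzA
      · exact IsPreconnected.union w (comp_frontier_subset hA z hw) hw.1 hAc.isPreconnected
          isPreconnected_connectedComponentIn.closure
  have := huc (closure (connectedComponentIn Aᶜ c)) (connectedComponentIn Aᶜ c)ᶜ isClosed_closure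
    (ho c).isClosed_compl ⟨⟨c, subset_closure (mem_connectedComponentIn hc)⟩,
      isPreconnected_connectedComponentIn.closure⟩ hco (by
      rw [eq_univ_iff_forall]
      intro z
      by_cases hz : z ∈ connectedComponentIn Aᶜ c
      · exact Or.inl (subset_closure hz)
      · exact Or.inr hz)
  rwa [(ho c).frontier_eq, sdiff_eq]

/-- The closed set attached to a piece `F` of the frontier. -/
def piece (A F : Set X) : Set X :=
  F ∪ {z | z ∉ A ∧ frontier (connectedComponentIn Aᶜ z) ⊆ F}

lemma piece_closed {A F₁ : Set X} (hA : IsClosed A) (h₁ : IsClosed F₁) :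
    IsClosed (piece A F₁) := by
  have ho : ∀ c, IsOpen (connectedComponentIn Aᶜ c) :=
    fun c => hA.isOpen_compl.connectedComponentIn
  rw [← closure_subset_iff_isClosed]
  unfold piece
  rw [closure_union, h₁.closure_eq]
  refine union_subset subset_union_left fun z hz => ?_
  by_cases hzA : z ∈ A
  · left
    by_contra hzF
    obtain ⟨N, hNo, hNc, hzN, hNs⟩ := exists_conn_nhd h₁.isOpen_compl hzF
    obtain ⟨w, hwN, hwA, hwF⟩ := mem_closure_iff.1 hz N hNo hzN
    obtain ⟨v, hvN, hv⟩ := meets_frontier (C := connectedComponentIn Aᶜ w) hNc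
      ⟨w, hwN, mem_connectedComponentIn hwA⟩
      ⟨z, hzN, fun h => connectedComponentIn_subset Aᶜ w h hzA⟩
    exact hNs hvN (hwF hv)
  · right
    obtain ⟨w, hwz, hwA, hwF⟩ := mem_closure_iff.1 hz _ (ho z) (mem_connectedComponentIn hzA)
    refine ⟨hzA, ?_⟩
    rwa [connectedComponentIn_eq hwz]

lemma piece_not_subset {A F₁ F₂ : Set X} (hA : IsClosed A) (h₂ : IsClosed F₂)
    (hd : Disjoint F₁ F₂)
    (hcomp : ∀ c, c ∉ A → frontier (connectedComponentIn Aᶜ c) ⊆ F₁ ∨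
      frontier (connectedComponentIn Aᶜ c) ⊆ F₂)
    (hne : (frontier A ∩ F₁).Nonempty) : ¬ piece A F₁ ⊆ A := by
  intro hs
  obtain ⟨z, hz, hz1⟩ := hne
  obtain ⟨N, hNo, hNc, hzN, hNs⟩ := exists_conn_nhd h₂.isOpen_compl
    (fun h => disjoint_left.1 hd hz1 h : z ∈ F₂ᶜ)
  rw [frontier_eq_closure_inter_closure] at hz
  obtain ⟨w, hwN, hwA⟩ := mem_closure_iff.1 hz.2 N hNo hzN
  have hzA : z ∈ A := hA.closure_eq ▸ hz.1
  rcases hcomp w hwA with h | h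
  · exact hwA (hs (Or.inr ⟨hwA, h⟩))
  · obtain ⟨v, hvN, hv⟩ := meets_frontier (C := connectedComponentIn Aᶜ w) hNc
      ⟨w, hwN, mem_connectedComponentIn hwA⟩
      ⟨z, hzN, fun h => connectedComponentIn_subset Aᶜ w h hzA⟩
    exact hNs hvN (h hv)

lemma exists_pieces (huc : Unicoherent X) {A : Set X} (hA : IsClosed A)
    (hAc : IsConnected A) (hfr : ¬ IsPreconnected (frontier A)) :
    ∃ K L : Set X, IsClosed K ∧ IsClosed L ∧ Disjoint K L ∧ (K ∪ L)ᶜ ⊆ A ∧ ¬ K ⊆ A ∧ ¬ L ⊆ A := by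
  rw [isPreconnected_iff_subset_of_fully_disjoint_closed isClosed_frontier] at hfr
  push Not at hfr
  obtain ⟨u, v, hu, hv, huv, hd, h1, h2⟩ := hfr
  obtain ⟨F₁, hF₁⟩ : ∃ F, F = u ∩ frontier A := ⟨_, rfl⟩
  obtain ⟨F₂, hF₂⟩ : ∃ F, F = v ∩ frontier A := ⟨_, rfl⟩
  have c1 : IsClosed F₁ := hF₁ ▸ hu.inter isClosed_frontier
  have c2 : IsClosed F₂ := hF₂ ▸ hv.inter isClosed_frontier
  have hdd : Disjoint F₁ F₂ := by
    rw [hF₁, hF₂]; exact hd.mono inter_subset_left inter_subset_left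
  have hfF : frontier A ⊆ F₁ ∪ F₂ := by
    intro z hz
    rcases huv hz with h | h
    · left; rw [hF₁]; exact ⟨h, hz⟩
    · right; rw [hF₂]; exact ⟨h, hz⟩
  have s1 : F₁ ⊆ A := by rw [hF₁]; exact fun z hz => hA.frontier_subset hz.2
  have s2 : F₂ ⊆ A := by rw [hF₂]; exact fun z hz => hA.frontier_subset hz.2
  have n1 : (frontier A ∩ F₁).Nonempty := by
    obtain ⟨z, hz, hzv⟩ := not_subset.1 h2
    have := (huv hz).resolve_right hzv
    exact ⟨z, hz, by rw [hF₁]; exact ⟨this, hz⟩⟩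
  have n2 : (frontier A ∩ F₂).Nonempty := by
    obtain ⟨z, hz, hzv⟩ := not_subset.1 h1
    have := (huv hz).resolve_left hzv
    exact ⟨z, hz, by rw [hF₂]; exact ⟨this, hz⟩⟩
  have hff : ∀ c, frontier (connectedComponentIn Aᶜ c) ⊆ frontier A := by
    intro c z hz
    rw [frontier_eq_closure_inter_closure]
    exact ⟨subset_closure (comp_frontier_subset hA c hz),
      closure_mono (connectedComponentIn_subset Aᶜ c) hz.1⟩
  have hcomp : ∀ c, c ∉ A → frontier (connectedComponentIn Aᶜ c) ⊆ F₁ ∨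
      frontier (connectedComponentIn Aᶜ c) ⊆ F₂ := by
    intro c hc
    exact (isPreconnected_iff_subset_of_fully_disjoint_closed isClosed_frontier).1
      (comp_frontier_connected huc hA hAc hc).isPreconnected F₁ F₂ c1 c2
      ((hff c).trans hfF) hdd
  refine ⟨piece A F₁, piece A F₂, piece_closed hA c1, piece_closed hA c2, ?_, ?_,
    piece_not_subset hA c2 hdd hcomp n1,
    piece_not_subset hA c1 hdd.symm (fun c hc => (hcomp c hc).symm) n2⟩
  · rw [disjoint_left]
    rintro z (hz | ⟨hzA, hz⟩) (hz' | ⟨hzA', hz'⟩)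
    · exact disjoint_left.1 hdd hz hz'
    · exact hzA' (s1 hz)
    · exact hzA (s2 hz')
    · obtain ⟨w, hw⟩ := comp_frontier_nonempty hAc.nonempty hzA
      exact disjoint_left.1 hdd (hz hw) (hz' hw)
  · intro z hz
    by_contra hzA
    rcases hcomp z hzA with h | h
    · exact hz (Or.inl (Or.inr ⟨hzA, h⟩))
    · exact hz (Or.inr (Or.inr ⟨hzA, h⟩))

lemma not_preconn_of_pieces {A K L : Set X} (hA : IsClosed A) (hK : IsClosed K)
    (hL : IsClosed L) (hd : Disjoint K L) (hcov : (K ∪ L)ᶜ ⊆ A) (hKA : ¬ K ⊆ A)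
    (hLA : ¬ L ⊆ A) : ¬ IsPreconnected (frontier A) := by
  intro hp
  have hfc : frontier A ⊆ K ∪ L := by
    rw [frontier_eq_closure_inter_closure]
    refine fun z hz => closure_minimal (s := Aᶜ) ?_ (hK.union hL) hz.2
    intro w hw
    by_contra h
    exact hw (hcov h)
  -- if the frontier lies in one piece, the other one gives a clopen set
  have key : ∀ K L : Set X, IsClosed K → IsClosed L → Disjoint K L → (K ∪ L)ᶜ ⊆ A → ¬ K ⊆ A →
      ¬ L ⊆ A → ¬ frontier A ⊆ K := by
    intro K L hK hL hd hcov hKA hLA hf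
    have hcl : IsClopen (L \ A) := by
      constructor
      · rw [← closure_subset_iff_isClosed]
        intro z hz
        have hzL : z ∈ L := closure_minimal sdiff_subset hL hz
        refine ⟨hzL, fun hzA => disjoint_left.1 hd (hf ?_) hzL⟩
        rw [frontier_eq_closure_inter_closure]
        exact ⟨subset_closure hzA, closure_mono (fun w hw => hw.2) hz⟩
      · have : L \ A = Aᶜ ∩ Kᶜ := by
          ext z
          constructor
          · exact fun hz => ⟨hz.2, fun h => disjoint_left.1 hd h hz.1⟩
          · intro hz
            refine ⟨?_, hz.1⟩
            by_contra h
            exact hz.1 (hcov (by rintro (h' | h'); exacts [hz.2 h', h h']))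
        rw [this]
        exact hA.isOpen_compl.inter hK.isOpen_compl
    obtain ⟨a, haK, -⟩ := not_subset.1 hKA
    obtain ⟨b, hbL, hbA⟩ := not_subset.1 hLA
    rcases isClopen_iff.1 hcl with h | h
    · exact (h ▸ (⟨hbL, hbA⟩ : b ∈ L \ A) : b ∈ (∅ : Set X))
    · exact disjoint_left.1 hd haK (h ▸ mem_univ a : a ∈ L \ A).1
  rcases (isPreconnected_iff_subset_of_fully_disjoint_closed isClosed_frontier).1 hp K L hK hL hfc hd
    with h | h
  · exact key K L hK hL hd hcov hKA hLA h
  · exact key L K hL hK hd.symm (by rwa [union_comm]) hLA hKA h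
end comp

/-- A countable family separating compact sets from closed sets. -/
lemma exists_countable_closed_family (X : Type*) [MetricSpace X] [CompactSpace X] :
    ∃ 𝓕 : Set (Set X), 𝓕.Countable ∧ (∀ F ∈ 𝓕, IsClosed F) ∧
      ∀ K U : Set X, IsClosed K → IsOpen U → K ⊆ U → ∃ F ∈ 𝓕, K ⊆ F ∧ F ⊆ U := by
  have hB := TopologicalSpace.isBasis_countableBasis X
  have hBc := TopologicalSpace.countable_countableBasis X
  refine ⟨(fun t : Set (Set X) => ⋃ b ∈ t, closure b) ''
    {t | t.Finite ∧ t ⊆ TopologicalSpace.countableBasis X},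
    (countable_ofPred_finite_subset hBc).image _, ?_, ?_⟩
  · rintro _ ⟨t, ht, rfl⟩
    exact ht.1.isClosed_biUnion fun _ _ => isClosed_closure
  · intro K U hK hU hKU
    have h : ∀ x ∈ K, ∃ b ∈ TopologicalSpace.countableBasis X, x ∈ b ∧ closure b ⊆ U :=
      fun x hx => hB.exists_closure_subset (hU.mem_nhds (hKU hx))
    choose! f hf1 hf2 hf3 using h
    obtain ⟨t, htK, ht⟩ := hK.isCompact.elim_nhds_subcover f
      fun x hx => (hB.isOpen (hf1 x hx)).mem_nhds (hf2 x hx)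
    refine ⟨_, ⟨f '' t, ⟨t.finite_toSet.image f, ?_⟩, rfl⟩, ?_, ?_⟩
    · rintro _ ⟨x, hx, rfl⟩
      exact hf1 x (htK x hx)
    · intro z hz
      obtain ⟨x, hx, hzx⟩ := mem_iUnion₂.1 (ht hz)
      exact mem_iUnion₂.2 ⟨f x, ⟨x, hx, rfl⟩, subset_closure hzx⟩
    · refine iUnion₂_subset ?_
      rintro _ ⟨x, hx, rfl⟩
      exact hf3 x (htK x hx)

lemma isClosed_superset {X : Type*} [MetricSpace X] (S : Set X) :
    IsClosed {A : Hyper X | S ⊆ A} := by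
  have : {A : Hyper X | S ⊆ A} = ⋂ s ∈ S, {A : Hyper X | infDist s (A : Set X) = 0} := by
    ext A
    simp only [mem_ofPred_eq, mem_iInter]
    exact ⟨fun h s hs => infDist_zero_of_mem (h hs),
      fun h s hs => (A.isCompact.isClosed.mem_iff_infDist_zero A.nonempty).2 (h s hs)⟩
  rw [this]
  exact isClosed_biInter fun s _ => isClosed_eq (lipschitz_infDist_set s).continuous
    continuous_const

lemma CBSet_isGdelta (X : Type*) [MetricSpace X] [CompactSpace X]
    [ConnectedSpace X] [LocallyConnectedSpace X] (huc : Unicoherent X) :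
    IsGδ ((Subtype.val ⁻¹' CBSet X) : Set ↥(CSet X)) := by
  obtain ⟨𝓕, hc, hcl, hsep⟩ := exists_countable_closed_family X
  let P : Set (Set X × Set X) := {p | p ∈ 𝓕 ×ˢ 𝓕 ∧ Disjoint p.1 p.2}
  have hP : P.Countable := (hc.prod hc).mono fun p hp => hp.1
  have hG : IsGδ ({A : Hyper X | univ ⊆ (A : Set X)}ᶜ ∩ ⋂ p ∈ P,
      ({A : Hyper X | (p.1 ∪ p.2)ᶜ ⊆ (A : Set X)}ᶜ ∪
        ({A : Hyper X | p.1 ⊆ (A : Set X)} ∪ {A : Hyper X | p.2 ⊆ (A : Set X)}))) := by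
    refine (isClosed_superset _).isOpen_compl.isGδ.inter (IsGδ.biInter hP fun p _ => ?_)
    exact (isClosed_superset _).isOpen_compl.isGδ.union
      ((isClosed_superset _).isGδ.union (isClosed_superset _).isGδ)
  convert hG.preimage continuous_subtype_val using 1
  ext ⟨A, hA⟩
  have hAcl : IsClosed (A : Set X) := A.isCompact.isClosed
  simp only [mem_preimage, CBSet, mem_ofPred_eq, mem_inter_iff, mem_compl_iff, mem_iInter,
    mem_union, univ_subset_iff]
  constructor
  · rintro ⟨-, hne, hf⟩
    refine ⟨hne, fun p hp => ?_⟩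
    by_contra hcon
    push Not at hcon
    exact not_preconn_of_pieces hAcl (hcl _ hp.1.1) (hcl _ hp.1.2) hp.2 hcon.1 hcon.2.1 hcon.2.2
      hf.isPreconnected
  · rintro ⟨hne, h⟩
    refine ⟨hA, hne, nonempty_frontier_iff.2 ⟨A.nonempty, hne⟩, ?_⟩
    by_contra hfr
    obtain ⟨K, L, hK, hL, hd, hcov, hKA, hLA⟩ := exists_pieces huc hAcl hA hfr
    obtain ⟨F, hF, hKF, hFL⟩ := hsep K Lᶜ hK hL.isOpen_compl
      fun z hz hz' => disjoint_left.1 hd hz hz'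
    obtain ⟨F', hF', hLF', hFF'⟩ := hsep L Fᶜ hL (hcl F hF).isOpen_compl
      fun z hz hz' => hFL hz' hz
    rcases h (F, F') ⟨⟨hF, hF'⟩, disjoint_left.2 fun z hz hz' => hFF' hz' hz⟩ with h | h | h
    · exact h (fun z hz => hcov fun hz' => hz (hz'.imp (@hKF z) (@hLF' z)))
    · exact hKA (hKF.trans h)
    · exact hLA (hLF'.trans h)

/-- `K` is a continuum irreducible between `x` and `y`. -/
structure Irr {X : Type*} [TopologicalSpace X] (K : Set X) (x y : X) : Prop where
  closed : IsClosed K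
  conn : IsPreconnected K
  left : x ∈ K
  right : y ∈ K
  min : ∀ M ⊆ K, IsClosed M → IsPreconnected M → x ∈ M → y ∈ M → K ⊆ M

/-- Connected open pieces of `K` avoiding the two end points. -/
structure GoodSet {X : Type*} [TopologicalSpace X] (K : Set X) (x y : X) (G : Set X) : Prop where
  isOpen : IsOpen G
  conn : IsPreconnected G
  nonempty : G.Nonempty
  sub : G ⊆ K
  left : x ∉ G
  right : y ∉ G

lemma Irr.symm {X : Type*} [TopologicalSpace X] {K : Set X} {x y : X} (h : Irr K x y) :
    Irr K y x :=
  ⟨h.closed, h.conn, h.right, h.left, fun M a b c d e => h.min M a b c e d⟩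

lemma GoodSet.symm {X : Type*} [TopologicalSpace X] {K G : Set X} {x y : X}
    (h : GoodSet K x y G) : GoodSet K y x G :=
  ⟨h.isOpen, h.conn, h.nonempty, h.sub, h.right, h.left⟩

/-- The points of `K` before `q`. -/
def before {X : Type*} [TopologicalSpace X] (K : Set X) (x y q : X) : Set X :=
  {z | ∃ G, GoodSet K x y G ∧ q ∈ G ∧ z ∈ connectedComponentIn (K \ G) x}

lemma isClosed_compIn {X : Type*} [TopologicalSpace X] {F : Set X} (hF : IsClosed F) (x : X) :
    IsClosed (connectedComponentIn F x) := by
  by_cases hx : x ∈ F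
  · rw [← closure_subset_iff_isClosed]
    exact isPreconnected_connectedComponentIn.closure.subset_connectedComponentIn
      (subset_closure (mem_connectedComponentIn hx))
      (closure_minimal (connectedComponentIn_subset F x) hF)
  · rw [connectedComponentIn_eq_empty hx]
    exact isClosed_empty

section irr
variable {X : Type*} [MetricSpace X] [CompactSpace X] {K G : Set X} {x y : X}

lemma closed_diff (hK : Irr K x y) (hG : GoodSet K x y G) : IsClosed (K \ G) := by
  rw [sdiff_eq]
  exact hK.closed.inter hG.isOpen.isClosed_compl

lemma closure_sub (hK : Irr K x y) (hG : GoodSet K x y G) : closure G ⊆ K :=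
  closure_minimal hG.sub hK.closed

lemma comp_disjoint (hK : Irr K x y) (hG : GoodSet K x y G) :
    Disjoint (connectedComponentIn (K \ G) x) (connectedComponentIn (K \ G) y) := by
  rw [disjoint_left]
  intro z hz hz'
  have e := (connectedComponentIn_eq hz).trans (connectedComponentIn_eq hz').symm
  obtain ⟨g, hg⟩ := hG.nonempty
  have hs := connectedComponentIn_subset (K \ G) x
  exact (hs (hK.min _ (hs.trans sdiff_subset) (isClosed_compIn (closed_diff hK hG) x)
    isPreconnected_connectedComponentIn (mem_connectedComponentIn ⟨hK.left, hG.left⟩)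
    (e ▸ mem_connectedComponentIn ⟨hK.right, hG.right⟩) (hG.sub hg))).2 hg

/-- Boundary bumping. -/
lemma comp_meets (hK : Irr K x y) (hG : GoodSet K x y G) :
    (connectedComponentIn (K \ G) x ∩ closure G).Nonempty := by
  by_contra hcon
  have hxF : x ∈ K \ G := ⟨hK.left, hG.left⟩
  have hFc := closed_diff hK hG
  have : CompactSpace ↥(K \ G) := isCompact_iff_compactSpace.1 hFc.isCompact
  obtain ⟨x', hx'⟩ : ∃ x' : ↥(K \ G), (x' : X) = x := ⟨⟨x, hxF⟩, rfl⟩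
  -- the trace of the closure
  have hsub : connectedComponent x' ⊆ (Subtype.val ⁻¹' (closure G) : Set ↥(K \ G))ᶜ := by
    intro z hz hz'
    apply hcon
    refine ⟨z, ?_, hz'⟩
    rw [connectedComponentIn_eq_image hxF]
    refine ⟨z, ?_, rfl⟩
    have : x' = ⟨x, hxF⟩ := Subtype.ext hx'
    rwa [← this]
  rw [connectedComponent_eq_iInter_isClopen] at hsub
  have : Nonempty { s : Set ↥(K \ G) // IsClopen s ∧ x' ∈ s } := ⟨⟨univ, isClopen_univ, mem_univ _⟩⟩
  have hdir : Directed (· ⊇ ·)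
      (fun s : { s : Set ↥(K \ G) // IsClopen s ∧ x' ∈ s } => (s : Set ↥(K \ G))) := by
    intro s t
    exact ⟨⟨s.1 ∩ t.1, s.2.1.inter t.2.1, s.2.2, t.2.2⟩, inter_subset_left, inter_subset_right⟩
  have hop : IsOpen (Subtype.val ⁻¹' (closure G) : Set ↥(K \ G))ᶜ :=
    (isClosed_closure.preimage continuous_subtype_val).isOpen_compl
  obtain ⟨⟨D, hD, hxD⟩, hDs⟩ := exists_subset_nhds_of_isCompact hdir
    (fun s => s.2.1.1.isCompact) (fun z hz => hop.mem_nhds (hsub hz))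
  have hD1 : IsClosed (Subtype.val '' D) := hFc.isClosedEmbedding_subtypeVal.isClosedMap _ hD.1
  have hD2 : IsClosed (Subtype.val '' Dᶜ) :=
    hFc.isClosedEmbedding_subtypeVal.isClosedMap _ hD.compl.1
  obtain ⟨g, hg⟩ := hG.nonempty
  obtain ⟨z, -, ⟨d, hd, rfl⟩, hz⟩ := isPreconnected_closed_iff.1 hK.conn
    (Subtype.val '' D) (Subtype.val '' Dᶜ ∪ closure G)
    hD1 (hD2.union isClosed_closure) (by
      intro z hz
      by_cases hzG : z ∈ G
      · exact Or.inr (Or.inr (subset_closure hzG))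
      · by_cases hzD : (⟨z, hz, hzG⟩ : ↥(K \ G)) ∈ D
        · exact Or.inl ⟨_, hzD, rfl⟩
        · exact Or.inr (Or.inl ⟨_, hzD, rfl⟩))
    ⟨x, hK.left, x', hxD, hx'⟩ ⟨g, hG.sub hg, Or.inr (subset_closure hg)⟩
  rcases hz with ⟨d', hd', e⟩ | hz
  · exact hd' (Subtype.ext e ▸ hd)
  · exact hDs hd hz

lemma comp_cover (hK : Irr K x y) (hG : GoodSet K x y G) :
    K ⊆ (connectedComponentIn (K \ G) x ∪ closure G) ∪ connectedComponentIn (K \ G) y := by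
  have hF := closed_diff hK hG
  obtain ⟨u, hu1, hu2⟩ := comp_meets hK hG
  obtain ⟨v, hv1, hv2⟩ := comp_meets hK.symm hG.symm
  have hs := fun x => (connectedComponentIn_subset (K \ G) x).trans sdiff_subset
  refine hK.min _ (union_subset (union_subset (hs x) (closure_sub hK hG)) (hs y))
    (((isClosed_compIn hF x).union isClosed_closure).union (isClosed_compIn hF y)) ?_
    (Or.inl (Or.inl (mem_connectedComponentIn ⟨hK.left, hG.left⟩)))
    (Or.inr (mem_connectedComponentIn ⟨hK.right, hG.right⟩))
  exact IsPreconnected.union v (Or.inr hv2) hv1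
    (IsPreconnected.union u hu1 hu2 isPreconnected_connectedComponentIn hG.conn.closure)
    isPreconnected_connectedComponentIn

variable [LocallyConnectedSpace X]

lemma GoodSet.shrink {q : X} (hG : GoodSet K x y G) {U : Set X} (hU : IsOpen U) (hqU : q ∈ U)
    (hqG : q ∈ G) : ∃ G', GoodSet K x y G' ∧ q ∈ G' ∧ G' ⊆ G ∧ G' ⊆ U := by
  obtain ⟨N, h1, h2, h3, h4⟩ := exists_conn_nhd (hU.inter hG.isOpen) ⟨hqU, hqG⟩
  exact ⟨N, ⟨h1, h2, ⟨q, h3⟩, fun z hz => hG.sub (h4 hz).2, fun h => hG.left (h4 h).2,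
    fun h => hG.right (h4 h).2⟩, h3, fun z hz => (h4 hz).2, fun z hz => (h4 hz).1⟩

lemma before_disjoint (hK : Irr K x y) (hG : GoodSet K x y G) {q : X} (hq : q ∈ G) :
    Disjoint (before K x y q) (connectedComponentIn (K \ G) y) := by
  rw [disjoint_left]
  rintro z ⟨G₁, hG₁, hq₁, hz⟩ hz'
  obtain ⟨G', hG', -, hs1, hs2⟩ := hG.shrink hG₁.isOpen hq₁ hq
  exact disjoint_left.1 (comp_disjoint hK hG')
    (connectedComponentIn_mono x (sdiff_subset_sdiff_right hs2) hz)
    (connectedComponentIn_mono y (sdiff_subset_sdiff_right hs1) hz')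

lemma comp_sub_before (hG : GoodSet K x y G) {q : X} (hq : q ∈ G) :
    connectedComponentIn (K \ G) x ⊆ before K x y q := fun _ hz => ⟨G, hG, hq, hz⟩

lemma before_sub (hK : Irr K x y) (hG : GoodSet K x y G) {q : X} (hq : q ∈ G) :
    before K x y q ⊆ connectedComponentIn (K \ G) x ∪ closure G := by
  intro z hz
  have hzK : z ∈ K := by
    obtain ⟨G₁, -, -, h⟩ := hz
    exact (connectedComponentIn_subset _ _ h).1
  exact (comp_cover hK hG hzK).resolve_right (disjoint_left.1 (before_disjoint hK hG hq) hz)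

lemma closure_sub_comp {Gp Gq : Set X} (hK : Irr K x y) (hp : GoodSet K x y Gp)
    (hq : GoodSet K x y Gq) (hd : Disjoint (closure Gp) (closure Gq)) {q : X} (hqG : q ∈ Gq)
    (h : q ∈ connectedComponentIn (K \ Gp) x) :
    closure Gp ⊆ connectedComponentIn (K \ Gq) y := by
  have h1 : closure Gq ⊆ connectedComponentIn (K \ Gp) x := by
    rw [connectedComponentIn_eq h]
    refine hq.conn.closure.subset_connectedComponentIn (subset_closure hqG) fun z hz => ?_
    exact ⟨closure_sub hK hq hz, fun hz' => disjoint_left.1 hd (subset_closure hz') hz⟩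
  obtain ⟨v, hv1, hv2⟩ := comp_meets hK.symm hp.symm
  have hM : IsPreconnected (connectedComponentIn (K \ Gp) y ∪ closure Gp) :=
    IsPreconnected.union v hv1 hv2 isPreconnected_connectedComponentIn hp.conn.closure
  refine subset_union_right.trans (hM.subset_connectedComponentIn
    (Or.inl (mem_connectedComponentIn ⟨hK.right, hp.right⟩)) ?_)
  rintro z (hz | hz)
  · exact ⟨(connectedComponentIn_subset _ _ hz).1, fun hz' =>
      disjoint_left.1 (comp_disjoint hK hp) (h1 (subset_closure hz')) hz⟩
  · exact ⟨closure_sub hK hp hz, fun hz' => disjoint_left.1 hd hz (subset_closure hz')⟩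

lemma mem_closure_before (hK : Irr K x y) (hG : GoodSet K x y G) {p : X} (hp : p ∈ G) :
    p ∈ closure (before K x y p) := by
  rw [mem_closure_iff_nhds]
  intro U hU
  obtain ⟨V, hV, hVc, hVU⟩ := exists_mem_nhds_isClosed_subset hU
  obtain ⟨G', hG', hp', -, hs⟩ := hG.shrink isOpen_interior (mem_interior_iff_mem_nhds.2 hV) hp
  obtain ⟨w, hw1, hw2⟩ := comp_meets hK hG'
  exact ⟨w, hVU (closure_minimal (hs.trans interior_subset) hVc hw2), comp_sub_before hG' hp' hw1⟩

lemma infDist_before (hK : Irr K x y) (hG : GoodSet K x y G) {q : X} (hq : q ∈ G) {δ : ℝ}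
    (hδ : 0 ≤ δ)
    (hdiam : ∀ z ∈ closure G, ∀ w ∈ closure G, dist z w ≤ δ) (d : X) :
    infDist d (before K x y q) ≤ infDist d (connectedComponentIn (K \ G) x) ∧
    infDist d (connectedComponentIn (K \ G) x) - δ ≤ infDist d (before K x y q) := by
  have hx : x ∈ connectedComponentIn (K \ G) x := mem_connectedComponentIn ⟨hK.left, hG.left⟩
  refine ⟨infDist_le_infDist_of_subset (comp_sub_before hG hq) ⟨x, hx⟩, ?_⟩
  refine (le_infDist ⟨x, comp_sub_before hG hq hx⟩).2 fun {z} hz => ?_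
  rcases before_sub hK hG hq hz with h | h
  · have := infDist_le_dist_of_mem (x := d) h
    linarith
  · obtain ⟨w, hw1, hw2⟩ := comp_meets hK hG
    have h1 := infDist_le_dist_of_mem (x := d) hw1
    have h2 := dist_triangle d z w
    have h3 := hdiam z h w hw2
    linarith

/-- The cut region. -/
def region (K : Set X) (x y : X) : Set X := {q | ∃ G, GoodSet K x y G ∧ q ∈ G}

lemma infDist_before_cont (hK : Irr K x y) (d : X) :
    ContinuousOn (fun q => infDist d (before K x y q)) (region K x y) := by
  rintro p ⟨G, hG, hp⟩
  apply ContinuousAt.continuousWithinAt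
  rw [Metric.continuousAt_iff']
  intro ε hε
  obtain ⟨G', hG', hp', -, hs⟩ := hG.shrink (isOpen_ball (x := p) (ε := ε / 4))
    (mem_ball_self (by linarith)) hp
  have hcl : closure G' ⊆ closedBall p (ε / 4) :=
    closure_minimal (hs.trans ball_subset_closedBall) isClosed_closedBall
  have hdiam : ∀ z ∈ closure G', ∀ w ∈ closure G', dist z w ≤ ε / 2 := by
    intro z hz w hw
    have h1 := mem_closedBall.1 (hcl hz)
    have h2 := mem_closedBall.1 (hcl hw)
    have h3 := dist_triangle_right z w p
    linarith
  filter_upwards [hG'.isOpen.mem_nhds hp'] with q hq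
  have a := infDist_before hK hG' hq (by linarith) hdiam d
  have b := infDist_before hK hG' hp' (by linarith) hdiam d
  rw [Real.dist_eq, abs_lt]
  constructor <;> linarith [a.1, a.2, b.1, b.2]

/-- The coordinate function. -/
def coord [Nonempty X] (K : Set X) (x y q : X) : ℝ :=
  ∑' n : ℕ, (1 / 2 : ℝ) ^ n * infDist (TopologicalSpace.denseSeq X n) (before K x y q)

lemma term_bound (s : Set X) (hs : s.Nonempty) (d : X) (n : ℕ) :
    ‖(1 / 2 : ℝ) ^ n * infDist d s‖ ≤ (1 / 2 : ℝ) ^ n * diam (univ : Set X) := by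
  obtain ⟨z, hz⟩ := hs
  rw [norm_mul, Real.norm_of_nonneg infDist_nonneg, Real.norm_of_nonneg (by positivity)]
  gcongr
  exact (infDist_le_dist_of_mem hz).trans
    (dist_le_diam_of_mem isCompact_univ.isBounded (mem_univ _) (mem_univ _))

lemma before_nonempty (hK : Irr K x y) {q : X} (hq : q ∈ region K x y) :
    (before K x y q).Nonempty := by
  obtain ⟨G, hG, hq⟩ := hq
  exact ⟨x, comp_sub_before hG hq (mem_connectedComponentIn ⟨hK.left, hG.left⟩)⟩

lemma bound_summable : Summable fun n : ℕ => (1 / 2 : ℝ) ^ n * diam (univ : Set X) :=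
  (summable_geometric_of_lt_one (by norm_num) (by norm_num)).mul_right _

lemma coord_cont [Nonempty X] (hK : Irr K x y) :
    ContinuousOn (coord K x y) (region K x y) :=
  continuousOn_tsum (fun n => continuousOn_const.mul (infDist_before_cont hK _))
    bound_summable fun n _q hq => term_bound _ (before_nonempty hK hq) _ n

lemma coord_lt [Nonempty X] {Gp Gq : Set X} (hK : Irr K x y) (hp : GoodSet K x y Gp)
    (hq : GoodSet K x y Gq) (hd : Disjoint (closure Gp) (closure Gq)) {p q : X} (hpG : p ∈ Gp)
    (hqG : q ∈ Gq)
    (h : q ∈ connectedComponentIn (K \ Gp) x) : coord K x y p < coord K x y q := by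
  have h1 := closure_sub_comp hK hp hq hd hqG h
  have hrp : p ∈ region K x y := ⟨Gp, hp, hpG⟩
  have hrq : q ∈ region K x y := ⟨Gq, hq, hqG⟩
  have hqd : ∀ z ∈ before K x y q, z ∉ closure Gp := fun z hz hz' =>
    disjoint_left.1 (before_disjoint hK hq hqG) hz (h1 hz')
  have hsub : before K x y q ⊆ before K x y p := by
    intro z hz
    refine comp_sub_before hp hpG ?_
    have hzK : z ∈ K := by
      obtain ⟨G₁, -, -, h⟩ := hz
      exact (connectedComponentIn_subset _ _ h).1
    rcases comp_cover hK hp hzK with (h2 | h2) | h2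
    · exact h2
    · exact absurd h2 (hqd z hz)
    · exfalso
      obtain ⟨v, hv1, hv2⟩ := comp_meets hK.symm hp.symm
      refine disjoint_left.1 (before_disjoint hK hq hqG) hz ?_
      have e := connectedComponentIn_eq (h1 hv2)
      rw [e]
      refine isPreconnected_connectedComponentIn.subset_connectedComponentIn hv1 ?_ h2
      intro w hw
      refine ⟨(connectedComponentIn_subset _ _ hw).1, fun hwq => ?_⟩
      have h3 : closure Gq ⊆ connectedComponentIn (K \ Gp) x := by
        rw [connectedComponentIn_eq h]
        refine hq.conn.closure.subset_connectedComponentIn (subset_closure hqG) fun z hz => ?_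
        exact ⟨closure_sub hK hq hz, fun hz' => disjoint_left.1 hd (subset_closure hz') hz⟩
      exact disjoint_left.1 (comp_disjoint hK hp) (h3 (subset_closure hwq)) hw
  obtain ⟨r, hr, hball⟩ := Metric.isOpen_iff.1 hp.isOpen p hpG
  obtain ⟨n, hn⟩ := (TopologicalSpace.denseRange_denseSeq X).exists_dist_lt p (half_pos hr)
  have hle : ∀ d, infDist d (before K x y p) ≤ infDist d (before K x y q) := fun d =>
    infDist_le_infDist_of_subset hsub (before_nonempty hK hrq)
  refine Summable.tsum_lt_tsum (i := n) (fun m => ?_) ?_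
    (bound_summable.of_norm_bounded fun m => term_bound _ (before_nonempty hK hrp) _ m)
    (bound_summable.of_norm_bounded fun m => term_bound _ (before_nonempty hK hrq) _ m)
  · exact mul_le_mul_of_nonneg_left (hle _) (by positivity)
  · refine mul_lt_mul_of_pos_left ?_ (by positivity)
    have a1 : infDist (TopologicalSpace.denseSeq X n) (before K x y p) < r / 2 := by
      rw [← infDist_closure]
      refine (infDist_le_dist_of_mem (mem_closure_before hK hp hpG)).trans_lt ?_
      rwa [dist_comm]
    refine a1.trans_le ((le_infDist (before_nonempty hK hrq)).2 fun {z} hz => ?_)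
    have h4 : r ≤ dist z p := by
      by_contra hlt
      exact hqd z hz (subset_closure (hball (mem_ball.2 (not_le.1 hlt))))
    have h5 := dist_triangle z (TopologicalSpace.denseSeq X n) p
    rw [dist_comm p] at hn
    rw [dist_comm z (TopologicalSpace.denseSeq X n)] at h5
    linarith

lemma coord_inj [Nonempty X] (hK : Irr K x y) : InjOn (coord K x y) (region K x y) := by
  rintro p ⟨Gp, hp, hpG⟩ q ⟨Gq, hq, hqG⟩ heq
  by_contra hne
  obtain ⟨U, hU, V, hV, hUV⟩ := exists_nhds_disjoint_closure hne
  obtain ⟨Gp', hp', hpG', -, hs⟩ := hp.shrink isOpen_interior (mem_interior_iff_mem_nhds.2 hU) hpG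
  obtain ⟨Gq', hq', hqG', -, hs'⟩ := hq.shrink isOpen_interior (mem_interior_iff_mem_nhds.2 hV) hqG
  have hd : Disjoint (closure Gp') (closure Gq') :=
    hUV.mono (closure_mono (hs.trans interior_subset)) (closure_mono (hs'.trans interior_subset))
  rcases comp_cover hK hp' (hq'.sub hqG') with (h | h) | h
  · exact (coord_lt hK hp' hq' hd hpG' hqG' h).ne heq
  · exact disjoint_left.1 hd h (subset_closure hqG')
  · have := closure_sub_comp hK.symm hp'.symm hq'.symm hd hqG' h (subset_closure hpG')
    exact (coord_lt hK hq' hp' hd.symm hqG' hpG' this).ne heq.symm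
end irr

lemma isFreeArc_closure {X : Type*} [MetricSpace X] [CompactSpace X] [ConnectedSpace X]
    [Nontrivial X] {G : Set X} (hG : IsOpen G) (hGc : IsPreconnected G) (hne : G.Nonempty)
    (f : X → ℝ) (hf : ContinuousOn f (closure G)) (hinj : InjOn f (closure G)) :
    IsFreeArc (closure G) := by
  have hcomp : IsCompact (closure G) := isClosed_closure.isCompact
  have hconn : IsConnected (closure G) := ⟨hne.closure, hGc.closure⟩
  obtain ⟨a, b, hI⟩ : ∃ a b : ℝ, f '' closure G = Icc a b :=
    ⟨_, _, eq_Icc_of_connected_compact (hconn.image f hf) (hcomp.image_of_continuousOn hf)⟩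
  obtain ⟨c, hc⟩ := hne
  obtain ⟨c', hc', hcc⟩ : ∃ c' ∈ G, c' ≠ c := by
    have hp := (isPreconnected_univ (α := X)).preperfect_of_nontrivial nontrivial_univ
    obtain ⟨y, hy, hyc⟩ := preperfect_iff_nhds.1 hp c (mem_univ _) G (hG.mem_nhds hc)
    exact ⟨y, hy.1, hyc⟩
  have hmem : ∀ z ∈ closure G, f z ∈ Icc a b := fun z hz => hI ▸ mem_image_of_mem f hz
  have hab : a < b := by
    by_contra h
    have h1 := hmem c (subset_closure hc)
    have h2 := hmem c' (subset_closure hc')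
    exact hcc (hinj (subset_closure hc') (subset_closure hc) (by linarith [h1.1, h1.2, h2.1, h2.2]))
  have : CompactSpace ↥(closure G) := isCompact_iff_compactSpace.1 hcomp
  let g : ↥(closure G) → Icc a b := fun z => ⟨f z, hmem z z.2⟩
  have hg : Continuous g := (continuousOn_iff_continuous_domRestrict.1 hf).subtype_mk _
  have hgb : Function.Bijective g := by
    constructor
    · intro z w h
      exact Subtype.ext (hinj z.2 w.2 (congrArg Subtype.val h))
    · rintro ⟨t, ht⟩
      rw [← hI] at ht
      obtain ⟨z, hz, rfl⟩ := ht
      exact ⟨⟨z, hz⟩, rfl⟩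
  let e0 : ↥(closure G) ≃ₜ Icc a b := hg.homeoOfEquivCompactToT2 (f := Equiv.ofBijective g hgb)
  let e : ↥(closure G) ≃ₜ unitInterval := e0.trans (iccHomeoI a b hab)
  refine ⟨e.symm, ?_⟩
  -- values at the end points
  have key : ∀ z : ↥(closure G), ((e z : unitInterval) : ℝ) = (f z - a) / (b - a) := fun z => by
    simp only [e, Homeomorph.trans_apply, iccHomeoI_apply_coe]
    rfl
  have hba : (b - a) ≠ 0 := by linarith
  have h0 : f (e.symm 0 : ↥(closure G)) = a := by
    have := key (e.symm 0)
    rw [e.apply_symm_apply] at this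
    have h2 : (f (e.symm 0 : ↥(closure G)) - a) / (b - a) = 0 := by rw [← this]; rfl
    rw [div_eq_zero_iff] at h2
    have := h2.resolve_right hba
    linarith
  have h1 : f (e.symm 1 : ↥(closure G)) = b := by
    have := key (e.symm 1)
    rw [e.apply_symm_apply] at this
    have h2 : (f (e.symm 1 : ↥(closure G)) - a) / (b - a) = 1 := by rw [← this]; rfl
    rw [div_eq_one_iff_eq hba] at h2
    linarith
  have hclos : ∀ z ∈ closure G, f z ∈ closure (f '' G) := fun z hz =>
    hf.image_closure (mem_image_of_mem f hz)
  have hs : closure G \ {((e.symm 0 : ↥(closure G)) : X), ((e.symm 1 : ↥(closure G)) : X)} =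
      G \ {((e.symm 0 : ↥(closure G)) : X), ((e.symm 1 : ↥(closure G)) : X)} := by
    apply Subset.antisymm _ (sdiff_subset_sdiff_left subset_closure)
    rintro z ⟨hz, hz'⟩
    refine ⟨?_, hz'⟩
    rw [mem_insert_iff, mem_singleton_iff, not_or] at hz'
    have hza : f z ≠ a := fun h => hz'.1 (hinj hz (e.symm 0).2 (h.trans h0.symm))
    have hzb : f z ≠ b := fun h => hz'.2 (hinj hz (e.symm 1).2 (h.trans h1.symm))
    have l1 : a < f z := lt_of_le_of_ne (hmem z hz).1 hza.symm
    have l2 : f z < b := lt_of_le_of_ne (hmem z hz).2 hzb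
    obtain ⟨u, hu, hu'⟩ := mem_closure_iff.1 (hclos _ (e.symm 0).2) (Iio (f z)) isOpen_Iio
      (by rw [h0]; exact l1)
    obtain ⟨v, hv, hv'⟩ := mem_closure_iff.1 (hclos _ (e.symm 1).2) (Ioi (f z)) isOpen_Ioi
      (by rw [h1]; exact l2)
    obtain ⟨w, hw, hwz⟩ := (hGc.image f (hf.mono subset_closure)).Icc_subset hu' hv'
      ⟨le_of_lt hu, le_of_lt hv⟩
    rw [← hinj (subset_closure hw) hz hwz]
    exact hw
  rw [hs]
  exact hG.sdiff (toFinite _).isClosed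

lemma irr_interior {X : Type*} [MetricSpace X] [CompactSpace X]
    [ConnectedSpace X] [Nontrivial X] [LocallyConnectedSpace X]
    (hfa : ∀ A : Set X, ¬ IsFreeArc A) {K : Set X} {x y : X} (hK : Irr K x y) :
    interior K = ∅ := by
  by_contra hne
  obtain ⟨c, hc⟩ := nonempty_iff_ne_empty.2 hne
  have hp := (isPreconnected_univ (α := X)).preperfect_of_nontrivial nontrivial_univ
  have hop : ∀ s : Set X, IsOpen s → s.Nonempty → ∀ z, (s \ {z}).Nonempty := by
    rintro s hs ⟨w, hw⟩ z
    by_cases h : w = z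
    · obtain ⟨v, hv, hvw⟩ := preperfect_iff_nhds.1 hp w (mem_univ _) s (hs.mem_nhds hw)
      exact ⟨v, hv.1, fun h' => hvw (h'.trans h.symm)⟩
    · exact ⟨w, hw, h⟩
  have o1 : IsOpen (interior K \ {x}) := isOpen_interior.sdiff isClosed_singleton
  have o2 : IsOpen ((interior K \ {x}) \ {y}) := o1.sdiff isClosed_singleton
  obtain ⟨c, hc⟩ := hop _ o1 (hop _ isOpen_interior ⟨c, hc⟩ x) y
  have hreg : (interior K \ {x}) \ {y} ⊆ region K x y := by
    intro q hq
    obtain ⟨N, n1, n2, n3, n4⟩ := exists_conn_nhd o2 hq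
    exact ⟨N, ⟨n1, n2, ⟨q, n3⟩, fun z hz => interior_subset (n4 hz).1.1,
      fun h => (n4 h).1.2 rfl, fun h => (n4 h).2 rfl⟩, n3⟩
  obtain ⟨V, hV, hVc, hVU⟩ := exists_mem_nhds_isClosed_subset (o2.mem_nhds hc)
  obtain ⟨N, n1, n2, n3, n4⟩ := exists_conn_nhd isOpen_interior (mem_interior_iff_mem_nhds.2 hV)
  have hN : closure N ⊆ region K x y :=
    ((closure_minimal (n4.trans interior_subset) hVc).trans hVU).trans hreg
  exact hfa _ (isFreeArc_closure n1 n2 ⟨c, n3⟩ (coord K x y) ((coord_cont hK).mono hN)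
    ((coord_inj hK).mono hN))

lemma exists_irr {X : Type*} [MetricSpace X] [CompactSpace X] {A : Set X} (hA : IsClosed A)
    (hAc : IsPreconnected A) {x y : X} (hx : x ∈ A) (hy : y ∈ A) : ∃ K ⊆ A, Irr K x y := by
  obtain ⟨K, hKA, hK⟩ := zorn_superset_nonempty
    {K : Set X | IsClosed K ∧ IsPreconnected K ∧ x ∈ K ∧ y ∈ K} (by
      intro c hc hch hcn
      have hcl : IsClosed (⋂₀ c) := isClosed_sInter fun s hs => (hc hs).1
      refine ⟨⋂₀ c, ⟨hcl, ?_, fun s hs => (hc hs).2.2.1,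
        fun s hs => (hc hs).2.2.2⟩, fun s hs => sInter_subset_of_mem hs⟩
      rw [isPreconnected_iff_subset_of_fully_disjoint_closed hcl]
      intro u v hu hv huv hd
      obtain ⟨U, V, hU, hV, hKU, hLV, hUV⟩ := normal_separation hu hv hd
      have : Nonempty c := hcn.to_subtype
      obtain ⟨⟨s, hs⟩, hsU⟩ := exists_subset_nhds_of_isCompact (V := fun s : c => (s : Set X))
        (U := U ∪ V)
        (by
          rintro ⟨s, hs⟩ ⟨t, ht⟩
          rcases hch.total hs ht with h | h
          · exact ⟨⟨s, hs⟩, Subset.rfl, h⟩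
          · exact ⟨⟨t, ht⟩, h, Subset.rfl⟩)
        (fun s => (hc s.2).1.isCompact)
        (fun z hz => (hU.union hV).mem_nhds (by
          rw [← sInter_eq_iInter] at hz
          exact (huv hz).imp (@hKU z) (@hLV z)))
      rcases (hc hs).2.1.subset_or_subset hU hV hUV hsU with h | h
      · left
        intro z hz
        exact (huv hz).resolve_right fun hz' => disjoint_left.1 hUV (h (hz s hs)) (hLV hz')
      · right
        intro z hz
        exact (huv hz).resolve_left fun hz' => disjoint_left.1 hUV (hKU hz') (h (hz s hs)))
    A ⟨hA, hAc, hx, hy⟩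
  refine ⟨K, hKA, hK.prop.1, hK.prop.2.1, hK.prop.2.2.1, hK.prop.2.2.2, ?_⟩
  intro M hM h1 h2 h3 h4
  exact hK.le_of_le ⟨h1, h2, h3, h4⟩ hM

lemma CBSet_dense (X : Type*) [MetricSpace X] [CompactSpace X]
    [ConnectedSpace X] [Nontrivial X] [LocallyConnectedSpace X]
    (hfa : ∀ A : Set X, ¬ IsFreeArc A) :
    Dense ((Subtype.val ⁻¹' CBSet X) : Set ↥(CSet X)) := by
  rintro ⟨A, hA⟩
  rw [Metric.mem_closure_iff]
  intro ε hε
  have hAcl : IsClosed (A : Set X) := A.isCompact.isClosed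
  obtain ⟨a₀, ha₀⟩ := A.nonempty
  obtain ⟨t, htA, htf, hcov⟩ := A.isCompact.finite_cover_balls (half_pos hε)
  have hex : ∀ a ∈ t, ∃ K ⊆ (A : Set X), Irr K a₀ a := fun a ha =>
    exists_irr hAcl hA.isPreconnected ha₀ (htA ha)
  choose! K hKA hK using hex
  have htn : t.Nonempty := by
    obtain ⟨a, ha, -⟩ := mem_iUnion₂.1 (hcov ha₀)
    exact ⟨a, ha⟩
  have hBcl : IsClosed (⋃ a ∈ t, K a) := htf.isClosed_biUnion fun a ha => (hK a ha).closed
  obtain ⟨b, hb⟩ := htn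
  have ha₀B : a₀ ∈ ⋃ a ∈ t, K a := mem_iUnion₂.2 ⟨b, hb, (hK b hb).left⟩
  have hBA : (⋃ a ∈ t, K a) ⊆ (A : Set X) := iUnion₂_subset hKA
  have hBc : IsConnected (⋃ a ∈ t, K a) := by
    refine ⟨⟨a₀, ha₀B⟩, isPreconnected_of_forall a₀ fun z hz => ?_⟩
    obtain ⟨a, ha, hza⟩ := mem_iUnion₂.1 hz
    exact ⟨K a, subset_biUnion_of_mem (u := K) ha, (hK a ha).left, hza, (hK a ha).conn⟩
  have hBi : interior (⋃ a ∈ t, K a) = ∅ := by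
    have : ∀ s : Set X, s.Finite → s ⊆ t → interior (⋃ a ∈ s, K a) = ∅ := by
      intro s hs
      induction s, hs using Set.Finite.induction_on with
      | empty => simp
      | @insert a s _ hs ih =>
        intro hst
        rw [biUnion_insert, interior_union_isClosed_of_interior_empty
          (hK a (hst (mem_insert _ _))).closed (ih ((subset_insert _ _).trans hst))]
        exact irr_interior hfa (hK a (hst (mem_insert _ _)))
    exact this t htf Subset.rfl
  let B : Hyper X := ⟨⟨⋃ a ∈ t, K a, hBcl.isCompact⟩, ⟨a₀, ha₀B⟩⟩
  have hB : (B : Set X) = ⋃ a ∈ t, K a := rfl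
  have hBS : B ∈ CSet X := hBc
  refine ⟨⟨B, hBS⟩, ⟨hBS, ?_, ?_⟩, ?_⟩
  · rw [hB]
    intro h
    rw [h, interior_univ] at hBi
    exact empty_ne_univ hBi.symm
  · rw [hB, hBcl.frontier_eq, hBi, sdiff_empty]
    exact hBc
  · rw [Subtype.dist_eq, Metric.NonemptyCompacts.dist_eq]
    refine (hausdorffDist_le_of_mem_dist (half_pos hε).le ?_ ?_).trans_lt (half_lt_self hε)
    · intro z hz
      obtain ⟨a, ha, hza⟩ := mem_iUnion₂.1 (hcov hz)
      exact ⟨a, mem_iUnion₂.2 ⟨a, ha, (hK a ha).right⟩, (mem_ball.1 hza).le⟩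
    · intro z hz
      exact ⟨z, hBA hz, by rw [dist_self]; exact (half_pos hε).le⟩

/-- If `X` is a nondegenerate unicoherent Peano continuum without free
arcs, then `CB(X)` is a dense `G_δ`-subset of `C(X)`. -/
theorem CBSet_dense_isGdelta (X : Type*) [MetricSpace X] [CompactSpace X]
    [ConnectedSpace X] [Nontrivial X] [LocallyConnectedSpace X]
    (huc : Unicoherent X) (hfa : ∀ A : Set X, ¬ IsFreeArc A) :
    IsGδ ((Subtype.val ⁻¹' CBSet X) : Set ↥(CSet X)) ∧
      Dense ((Subtype.val ⁻¹' CBSet X) : Set ↥(CSet X)) := by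
  exact ⟨CBSet_isGdelta X huc, CBSet_dense X hfa⟩
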